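/- arXiv:2103.15479 — 2 statements merged into one kernel-verified Lean document; each statement's English description precedes it below -/
import Mathlib

section
/- Let f(X) = a_0 + a_1 X + ... + a_n X^n be an Eneström–Kakeya polynomial of degree n ≥ 1 with integer coefficients and a_0 ≠ 0, and let a, b be two integers with a² < b² and |a+b| > 2. Then f is irreducible over ℚ in each of the following cases: (i) |f(a)| = p^k·r and |f(b)| = p^{k+1} for some prime p and integers k, r with k ≥ 0 and 0 < r < p; (ii) |f(a)| = p^k and |f(b)| = p^k·r for some primes p, r with r < p and some integer k ≥ 1. -/
open Polynomial

/-- If `0 ≤ c 0 ≤ ⋯ ≤ c m` and `1 ≤ ‖z‖`, then `(z - 1) ∑ c i z ^ i` differs from its leading term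
`c m z ^ (m + 1)` by at most `c m ‖z‖ ^ m`. -/
theorem norm_sub_one_mul_sum_sub_le {z : ℂ} (hz : 1 ≤ ‖z‖) (c : ℕ → ℝ) (h0 : 0 ≤ c 0) (m : ℕ)
    (hc : ∀ i < m, c i ≤ c (i + 1)) :
    0 ≤ c m ∧ ‖(z - 1) * ∑ i ∈ Finset.range (m + 1), (c i : ℂ) * z ^ i - c m * z ^ (m + 1)‖
      ≤ c m * ‖z‖ ^ m := by
  induction m with
  | zero =>
    refine ⟨h0, ?_⟩
    have : (z - 1) * ∑ i ∈ Finset.range (0 + 1), (c i : ℂ) * z ^ i - c 0 * z ^ (0 + 1)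
        = -(c 0 : ℂ) := by
      simp; ring
    rw [this]
    simp [abs_of_nonneg h0]
  | succ m ih =>
    obtain ⟨hm, hb⟩ := ih fun i hi => hc i (by omega)
    have hstep := hc m (by omega)
    refine ⟨hm.trans hstep, ?_⟩
    have key : (z - 1) * ∑ i ∈ Finset.range (m + 1 + 1), (c i : ℂ) * z ^ i
          - c (m + 1) * z ^ (m + 1 + 1)
        = ((z - 1) * ∑ i ∈ Finset.range (m + 1), (c i : ℂ) * z ^ i - c m * z ^ (m + 1))
          - ((c (m + 1) - c m : ℝ) : ℂ) * z ^ (m + 1) := by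
      rw [Finset.sum_range_succ _ (m + 1)]
      push_cast
      ring
    rw [key]
    refine (norm_sub_le _ _).trans ?_
    rw [norm_mul, norm_pow, Complex.norm_real, Real.norm_of_nonneg (sub_nonneg.2 hstep)]
    have hpow : ‖z‖ ^ m ≤ ‖z‖ ^ (m + 1) := pow_le_pow_right₀ hz (Nat.le_succ m)
    nlinarith [mul_le_mul_of_nonneg_left hpow hm]

/-- **Eneström–Kakeya theorem** for integer polynomials. -/
theorem norm_le_one_of_aeval_eq_zero_of_coeff_le {f : ℤ[X]} (hf : f ≠ 0) (h0 : 0 ≤ f.coeff 0)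
    (hmono : ∀ i < f.natDegree, f.coeff i ≤ f.coeff (i + 1)) {z : ℂ} (hz : aeval z f = 0) :
    ‖z‖ ≤ 1 := by
  by_contra! h
  obtain ⟨hn, hb⟩ := norm_sub_one_mul_sum_sub_le h.le (fun i => (f.coeff i : ℝ))
    (by exact_mod_cast h0) f.natDegree (fun i hi => by exact_mod_cast hmono i hi)
  have hsum : ∑ i ∈ Finset.range (f.natDegree + 1), ((f.coeff i : ℝ) : ℂ) * z ^ i = 0 := by
    rw [← hz, aeval_eq_sum_range]
    simp
  rw [hsum, mul_zero, zero_sub, norm_neg, norm_mul, norm_pow, Complex.norm_real,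
    Real.norm_of_nonneg hn] at hb
  have hlead : (0 : ℝ) < f.coeff f.natDegree :=
    lt_of_le_of_ne hn (by exact_mod_cast (leadingCoeff_ne_zero.2 hf).symm)
  have hlt : ‖z‖ ^ f.natDegree < ‖z‖ ^ (f.natDegree + 1) := pow_lt_pow_right₀ h (Nat.lt_succ_self _)
  exact absurd hb (not_le.2 (mul_lt_mul_of_pos_left hlt hlead))

/-- If `|a| < |b|` and `2 < |a + b|`, points of the closed unit disc are closer to `a` than
to `b`. -/
theorem norm_sub_lt_norm_sub_of_norm_le_one {a b : ℝ} (hab : a ^ 2 < b ^ 2) (habs : 2 < |a + b|)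
    {z : ℂ} (hz : ‖z‖ ≤ 1) : ‖(a : ℂ) - z‖ < ‖(b : ℂ) - z‖ := by
  have hre := abs_le.1 ((Complex.abs_re_le_norm z).trans hz)
  refine lt_of_pow_lt_pow_left₀ 2 (norm_nonneg _) ?_
  rw [Complex.sq_norm, Complex.sq_norm, Complex.normSq_apply, Complex.normSq_apply]
  simp only [Complex.sub_re, Complex.sub_im, Complex.ofReal_re, Complex.ofReal_im]
  rcases lt_abs.1 habs with h | h
  · have : 0 < b - a := by nlinarith
    nlinarith
  · have : b - a < 0 := by nlinarith
    nlinarith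

theorem Multiset.prod_map_lt_prod_map_of_nonneg {ι : Type*} {s : Multiset ι} (hs : s ≠ 0)
    {u v : ι → ℝ} (h0 : ∀ x ∈ s, 0 ≤ u x) (h : ∀ x ∈ s, u x < v x) :
    (s.map u).prod < (s.map v).prod := by
  induction s using Multiset.induction with
  | empty => exact absurd rfl hs
  | cons x s ih =>
    rw [Multiset.map_cons, Multiset.map_cons, Multiset.prod_cons, Multiset.prod_cons]
    have hx := h x (Multiset.mem_cons_self x s)
    have hx0 := h0 x (Multiset.mem_cons_self x s)
    rcases eq_or_ne s 0 with rfl | hs'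
    · simpa using hx
    · have hlt := ih hs' (fun y hy => h0 y (Multiset.mem_cons_of_mem hy))
        fun y hy => h y (Multiset.mem_cons_of_mem hy)
      have hnn : 0 ≤ (s.map u).prod := by
        refine Multiset.prod_nonneg fun y hy => ?_
        obtain ⟨w, hw, rfl⟩ := Multiset.mem_map.1 hy
        exact h0 w (Multiset.mem_cons_of_mem hw)
      exact mul_lt_mul'' hx hlt hx0 hnn

theorem norm_eval_eq_norm_leadingCoeff_mul_prod_roots (P : ℂ[X]) (x : ℂ) :
    ‖P.eval x‖ = ‖P.leadingCoeff‖ * (P.roots.map fun z => ‖x - z‖).prod := by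
  rw [(IsAlgClosed.splits P).eval_eq_prod_roots, norm_mul]
  congr 1
  rw [← normHom_apply, map_multiset_prod, Multiset.map_map]
  rfl

theorem natAbs_eval_lt_natAbs_eval {g : ℤ[X]} (hg : 0 < g.natDegree)
    (hroots : ∀ z : ℂ, aeval z g = 0 → ‖z‖ ≤ 1) {a b : ℤ} (hab : a ^ 2 < b ^ 2)
    (habs : 2 < |a + b|) : (g.eval a).natAbs < (g.eval b).natAbs := by
  have hinj : Function.Injective (Int.castRingHom ℂ) := Int.cast_injective
  set P := g.map (Int.castRingHom ℂ) with hP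
  have hdeg : P.natDegree = g.natDegree := natDegree_map_eq_of_injective hinj g
  have hP0 : P ≠ 0 := by
    rintro h
    rw [h, natDegree_zero] at hdeg
    omega
  have hroots0 : P.roots ≠ 0 := by
    intro h
    have := (IsAlgClosed.splits P).natDegree_eq_card_roots
    rw [h, Multiset.card_zero] at this
    omega
  have heval (x : ℤ) : ((g.eval x).natAbs : ℝ) = ‖P.eval (x : ℂ)‖ := by
    rw [hP, eval_intCast_map]
    simp [Nat.cast_natAbs]
  rw [← Nat.cast_lt (α := ℝ), heval, heval, norm_eval_eq_norm_leadingCoeff_mul_prod_roots,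
    norm_eval_eq_norm_leadingCoeff_mul_prod_roots]
  refine mul_lt_mul_of_pos_left ?_ (norm_pos_iff.2 (leadingCoeff_ne_zero.2 hP0))
  refine Multiset.prod_map_lt_prod_map_of_nonneg hroots0 (fun _ _ => norm_nonneg _) fun z hz => ?_
  have hz1 : ‖z‖ ≤ 1 := hroots z (by
    have := (mem_roots hP0).1 hz
    rwa [IsRoot.def, hP, eval_map, ← algebraMap_int_eq, ← aeval_def] at this)
  simpa using norm_sub_lt_norm_sub_of_norm_le_one (a := a) (b := b)
    (by exact_mod_cast hab) (by exact_mod_cast habs) hz1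

/-- A polynomial of positive degree over `ℤ` that is reducible over `ℚ` is a product of two
integer polynomials of positive degree. -/
theorem exists_mul_eq_of_not_irreducible_map {f : ℤ[X]} (hdeg : 0 < f.natDegree)
    (hf : ¬ Irreducible (f.map (Int.castRingHom ℚ))) :
    ∃ g h : ℤ[X], 0 < g.natDegree ∧ 0 < h.natDegree ∧ f = g * h := by
  have hf0 : f ≠ 0 := by rintro rfl; simp at hdeg
  have hc : f.content ≠ 0 := fun h => hf0 (content_eq_zero_iff.1 h)
  have hprim := f.isPrimitive_primPart
  have hnot : ¬ Irreducible f.primPart := by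
    rw [IsPrimitive.Int.irreducible_iff_irreducible_map_cast hprim]
    intro h
    refine hf ?_
    rw [f.eq_C_content_mul_primPart, Polynomial.map_mul, map_C]
    refine (irreducible_isUnit_mul (isUnit_C.2 ?_)).2 h
    simpa using hc
  have hnu : ¬ IsUnit f.primPart := by
    intro h
    have := natDegree_eq_zero_of_isUnit h
    rw [natDegree_primPart] at this
    omega
  have hpos {q : ℤ[X]} (hq : q ∣ f.primPart) (hu : ¬ IsUnit q) : 0 < q.natDegree := by
    by_contra! h
    obtain ⟨c, rfl⟩ := natDegree_eq_zero.1 (Nat.le_zero.1 h)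
    exact hu (isUnit_C.2 (hprim c hq))
  rw [irreducible_iff] at hnot
  push Not at hnot
  obtain ⟨g, h, hgh, hg, hh⟩ := hnot hnu
  refine ⟨C f.content * g, h, ?_, hpos (hgh ▸ dvd_mul_left h g) hh, ?_⟩
  · rw [natDegree_C_mul hc]
    exact hpos (hgh ▸ dvd_mul_right g h) hg
  · rw [mul_assoc, ← hgh, ← f.eq_C_content_mul_primPart]

theorem Nat.Prime.eq_and_eq_of_pow_mul_eq_pow_mul {p m n u v : ℕ} (hp : p.Prime) (hu : ¬ p ∣ u)
    (hv : ¬ p ∣ v) (h : p ^ m * u = p ^ n * v) : m = n ∧ u = v := by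
  have hmn : m = n := by
    have := Fact.mk hp
    have hu0 : u ≠ 0 := by rintro rfl; simp at hu
    have hv0 : v ≠ 0 := by rintro rfl; simp at hv
    have hval := congrArg (padicValNat p) h
    rwa [padicValNat.mul (pow_ne_zero _ hp.ne_zero) hu0,
      padicValNat.mul (pow_ne_zero _ hp.ne_zero) hv0, padicValNat.prime_pow,
      padicValNat.prime_pow, padicValNat.eq_zero_of_not_dvd hu,
      padicValNat.eq_zero_of_not_dvd hv] at hval
  subst hmn
  exact ⟨rfl, Nat.eq_of_mul_eq_mul_left (pow_pos hp.pos m) h⟩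

/-- A factorization `A * B = p ^ k * r` with `p ∤ r` splits the prime-to-`p` part. -/
theorem Nat.Prime.exists_pow_mul_of_mul_eq_pow_mul {p A B k r : ℕ} (hp : p.Prime) (hr : ¬ p ∣ r)
    (h : A * B = p ^ k * r) :
    ∃ i j s t, A = p ^ i * s ∧ B = p ^ j * t ∧ i + j = k ∧ s * t = r := by
  have hr0 : r ≠ 0 := by rintro rfl; simp at hr
  have hAB : A * B ≠ 0 := h ▸ mul_ne_zero (pow_ne_zero _ hp.ne_zero) hr0
  obtain ⟨i, s, hs, hA⟩ :=
    Nat.exists_eq_pow_mul_and_not_dvd (left_ne_zero_of_mul hAB) p hp.ne_one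
  obtain ⟨j, t, ht, hB⟩ :=
    Nat.exists_eq_pow_mul_and_not_dvd (right_ne_zero_of_mul hAB) p hp.ne_one
  refine ⟨i, j, s, t, hA, hB, hp.eq_and_eq_of_pow_mul_eq_pow_mul (hp.not_dvd_mul hs ht) hr ?_⟩
  rw [← h, hA, hB]
  ring

theorem Nat.Prime.not_mul_eq_pow_mul_and_mul_eq_pow_succ {p A B C D k r : ℕ} (hp : p.Prime)
    (hr0 : 0 < r) (hr : r < p) (hAC : A < C) (hBD : B < D) (h₁ : A * B = p ^ k * r)
    (h₂ : C * D = p ^ (k + 1)) : False := by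
  obtain ⟨i, j, s, t, rfl, rfl, hij, hst⟩ :=
    hp.exists_pow_mul_of_mul_eq_pow_mul (Nat.not_dvd_of_pos_of_lt hr0 hr) h₁
  obtain ⟨i', j', s', t', rfl, rfl, hij', hst'⟩ :=
    hp.exists_pow_mul_of_mul_eq_pow_mul hp.not_dvd_one (h₂.trans (mul_one _).symm)
  obtain ⟨rfl, rfl⟩ := mul_eq_one.1 hst'
  have hs : 0 < s := Nat.pos_of_ne_zero (by rintro rfl; simp at hst; omega)
  have ht : 0 < t := Nat.pos_of_ne_zero (by rintro rfl; simp at hst; omega)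
  rw [mul_one] at hAC hBD
  have hi := (Nat.pow_lt_pow_iff_right hp.one_lt).1
    ((Nat.le_mul_of_pos_right _ hs).trans_lt hAC)
  have hj := (Nat.pow_lt_pow_iff_right hp.one_lt).1
    ((Nat.le_mul_of_pos_right _ ht).trans_lt hBD)
  omega

theorem Nat.Prime.not_mul_eq_pow_and_mul_eq_pow_mul_prime {p A B C D k r : ℕ} (hp : p.Prime)
    (hr' : r.Prime) (hr : r < p) (hAC : A < C) (hBD : B < D) (h₁ : A * B = p ^ k)
    (h₂ : C * D = p ^ k * r) : False := by
  obtain ⟨i, j, s, t, rfl, rfl, hij, hst⟩ :=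
    hp.exists_pow_mul_of_mul_eq_pow_mul hp.not_dvd_one (h₁.trans (mul_one _).symm)
  obtain ⟨i', j', s', t', rfl, rfl, hij', hst'⟩ :=
    hp.exists_pow_mul_of_mul_eq_pow_mul (Nat.not_dvd_of_pos_of_lt hr'.pos hr) h₂
  obtain ⟨rfl, rfl⟩ := mul_eq_one.1 hst
  have hs : s' < p := (Nat.le_of_dvd hr'.pos ⟨t', hst'.symm⟩).trans_lt hr
  have ht : t' < p := (Nat.le_of_dvd hr'.pos ⟨s', by rw [← hst', mul_comm]⟩).trans_lt hr
  rw [mul_one] at hAC hBD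
  have hle {m n u : ℕ} (hu : u < p) (h : p ^ m < p ^ n * u) : m ≤ n := by
    refine Nat.lt_succ_iff.1 ((Nat.pow_lt_pow_iff_right hp.one_lt).1 (h.trans ?_))
    rw [pow_succ]
    exact Nat.mul_lt_mul_of_pos_left hu (pow_pos hp.pos n)
  have hi := hle hs hAC
  have hj := hle ht hBD
  obtain rfl : i = i' := by omega
  obtain rfl : j = j' := by omega
  have hs1 := lt_of_mul_lt_mul_left' ((mul_one _).trans_lt hAC)
  have ht1 := lt_of_mul_lt_mul_left' ((mul_one _).trans_lt hBD)
  exact Nat.not_prime_mul hs1.ne' ht1.ne' (hst' ▸ hr')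

theorem statement_8 (f : Polynomial ℤ) (hdeg : 1 ≤ f.natDegree)
    (hEK0 : 0 ≤ f.coeff 0)
    (hEKmono : ∀ i < f.natDegree, f.coeff i ≤ f.coeff (i + 1))
    (h0 : f.coeff 0 ≠ 0) (a b : ℤ)
    (hab : a ^ 2 < b ^ 2) (habs : 2 < |a + b|)
    (hcase :
      (∃ p : ℕ, p.Prime ∧ ∃ (k : ℕ) (r : ℤ), 0 < r ∧ r < (p : ℤ) ∧
        |f.eval a| = (p : ℤ) ^ k * r ∧ |f.eval b| = (p : ℤ) ^ (k + 1)) ∨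
      (∃ p r : ℕ, p.Prime ∧ r.Prime ∧ r < p ∧ ∃ k : ℕ, 1 ≤ k ∧
        |f.eval a| = (p : ℤ) ^ k ∧ |f.eval b| = (p : ℤ) ^ k * (r : ℤ))) :
    Irreducible (Polynomial.map (Int.castRingHom ℚ) f) := by
  by_contra hirr
  obtain ⟨g, h, hg, hh, rfl⟩ := exists_mul_eq_of_not_irreducible_map hdeg hirr
  have hf0 : g * h ≠ 0 := fun hf => h0 (by rw [hf, coeff_zero])
  have hroots (z : ℂ) (hz : aeval z (g * h) = 0) : ‖z‖ ≤ 1 :=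
    norm_le_one_of_aeval_eq_zero_of_coeff_le hf0 hEK0 hEKmono hz
  have hglt := natAbs_eval_lt_natAbs_eval hg
    (fun z hz => hroots z (by rw [map_mul, hz, zero_mul])) hab habs
  have hhlt := natAbs_eval_lt_natAbs_eval hh
    (fun z hz => hroots z (by rw [map_mul, hz, mul_zero])) hab habs
  simp only [eval_mul, Int.abs_eq_natAbs, Int.natAbs_mul] at hcase
  rcases hcase with ⟨p, hp, k, r, hr0, hr, h₁, h₂⟩ | ⟨p, r, hp, hr', hr, k, -, h₁, h₂⟩
  · lift r to ℕ using hr0.le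
    exact hp.not_mul_eq_pow_mul_and_mul_eq_pow_succ (by exact_mod_cast hr0) (by exact_mod_cast hr)
      hglt hhlt (by exact_mod_cast h₁) (by exact_mod_cast h₂)
  · exact hp.not_mul_eq_pow_and_mul_eq_pow_mul_prime hr' hr hglt hhlt
      (by exact_mod_cast h₁) (by exact_mod_cast h₂)
end

section
/- Let f(X) = a_0 + a_1 X + ... + a_n X^n be a polynomial with integer coefficients of degree n ≥ 1, and let a, b be two integers such that a² < b² and |a_n| > Σ_{i=0}^{n-1} |a_i| · (|a+b|/2)^{i−n}. Suppose |f(a)| = p^u·q^v and |f(b)| = r^k·s^l for four distinct prime numbers p, q, r, s and positive integers u, v, k, l with p^u > r^k > s^l > q^v, p^u·q^v < r^k·s^l, p ∤ f'(a), q ∤ f'(a), r ∤ f'(b) and s ∤ f'(b). Then f is irreducible over ℚ. -/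
open Polynomial

/-- If every factorization over `ℤ` of a polynomial has a constant factor, then the polynomial is
irreducible over `ℚ`. -/
theorem irreducible_map_rat_of_forall_natDegree_eq_zero {f : ℤ[X]} (hf : f.natDegree ≠ 0)
    (h : ∀ g h : ℤ[X], f = g * h → g.natDegree = 0 ∨ h.natDegree = 0) :
    Irreducible (f.map (Int.castRingHom ℚ)) := by
  have hf0 : f ≠ 0 := by rintro rfl; simp at hf
  have isUnit_of_dvd : ∀ g : ℤ[X], g ∣ f.primPart → g.natDegree = 0 → IsUnit g := by
    intro g hg hd
    obtain ⟨c, rfl⟩ := natDegree_eq_zero.1 hd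
    exact (f.isPrimitive_primPart c hg).map C
  have hirr : Irreducible f.primPart := by
    refine ⟨fun hu => hf ?_, fun g k hgk => ?_⟩
    · rw [← natDegree_primPart]
      exact natDegree_eq_zero_of_isUnit hu
    · have hfac : f = (C f.content * g) * k := by
        rw [mul_assoc, ← hgk, ← eq_C_content_mul_primPart]
      refine (h _ _ hfac).imp (fun hg => ?_) fun hk => ?_
      · refine isUnit_of_dvd g ⟨k, hgk⟩ ?_
        rwa [natDegree_C_mul (by simpa [content_eq_zero_iff] using hf0)] at hg
      · exact isUnit_of_dvd k ⟨g, by rw [hgk, mul_comm]⟩ hk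
  rw [IsPrimitive.Int.irreducible_iff_irreducible_map_cast f.isPrimitive_primPart] at hirr
  rw [f.eq_C_content_mul_primPart, Polynomial.map_mul, map_C]
  refine (irreducible_isUnit_mul (isUnit_C.2 (IsUnit.mk0 _ ?_))).2 hirr
  simpa [content_eq_zero_iff] using hf0

/-- If the leading coefficient dominates the other ones at radius `ρ`, then all the roots lie in
the open disc of radius `ρ`. -/
theorem Polynomial.IsRoot.norm_lt_of_sum_lt_norm_leadingCoeff {K : Type*} [NormedField K]
    {f : K[X]} {ρ : ℝ} (hρ : 0 < ρ)
    (hf : ∑ i ∈ Finset.range f.natDegree, ‖f.coeff i‖ * ρ ^ ((i : ℤ) - (f.natDegree : ℤ)) <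
      ‖f.leadingCoeff‖) {z : K} (hz : f.IsRoot z) : ‖z‖ < ρ := by
  by_contra! hle
  have hz0 : 0 < ‖z‖ := hρ.trans_le hle
  have hsum : f.leadingCoeff * z ^ f.natDegree =
      -∑ i ∈ Finset.range f.natDegree, f.coeff i * z ^ i := by
    have := hz.eq_zero
    rw [eval_eq_sum_range, Finset.sum_range_succ] at this
    exact eq_neg_of_add_eq_zero_right this
  have hnorm : ‖f.leadingCoeff‖ * ‖z‖ ^ f.natDegree ≤
      ∑ i ∈ Finset.range f.natDegree, ‖f.coeff i‖ * ‖z‖ ^ i := by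
    rw [← norm_pow, ← norm_mul, hsum, norm_neg]
    refine (norm_sum_le _ _).trans_eq ?_
    simp
  refine hf.not_ge (le_of_mul_le_mul_right (hnorm.trans ?_) (pow_pos hz0 f.natDegree))
  rw [Finset.sum_mul]
  refine Finset.sum_le_sum fun i hi => ?_
  have hin : i < f.natDegree := Finset.mem_range.1 hi
  have hexp : ‖z‖ ^ i = ‖z‖ ^ ((i : ℤ) - (f.natDegree : ℤ)) * ‖z‖ ^ f.natDegree := by
    rw [← zpow_natCast, ← zpow_natCast, ← zpow_add₀ hz0.ne', sub_add_cancel]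
  rw [hexp, ← mul_assoc]
  have hpow : ‖z‖ ^ ((i : ℤ) - (f.natDegree : ℤ)) ≤ ρ ^ ((i : ℤ) - (f.natDegree : ℤ)) := by
    rw [← neg_sub, zpow_neg, zpow_neg]
    have hnn : (0 : ℤ) ≤ (f.natDegree : ℤ) - i := by omega
    exact inv_anti₀ (zpow_pos hρ _) (zpow_le_zpow_left₀ hnn hρ.le hle)
  gcongr

/-- Points of the disc of radius `|a + b| / 2` around the origin are closer to the one of `a`, `b`
which has the smaller absolute value. -/
theorem Complex.norm_ofReal_sub_lt_of_norm_lt {a b : ℝ} (hab : a ^ 2 < b ^ 2) {z : ℂ}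
    (hz : ‖z‖ < |a + b| / 2) : ‖(a : ℂ) - z‖ < ‖(b : ℂ) - z‖ := by
  have hre : |z.re| < |a + b| / 2 := (Complex.abs_re_le_norm z).trans_lt hz
  have hprod : 0 < (b - a) * (a + b) := by linarith
  have key : 0 < (b - a) * (a + b - 2 * z.re) := by
    rcases abs_lt.1 hre with ⟨hl, hu⟩
    rcases pos_and_pos_or_neg_and_neg_of_mul_pos hprod with ⟨h1, h2⟩ | ⟨h1, h2⟩
    · rw [abs_of_pos h2] at hl hu
      exact mul_pos h1 (by linarith)
    · rw [abs_of_neg h2] at hl hu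
      exact mul_pos_of_neg_of_neg h1 (by linarith)
  refine lt_of_pow_lt_pow_left₀ 2 (norm_nonneg _) ?_
  rw [Complex.sq_norm, Complex.sq_norm, Complex.normSq_apply, Complex.normSq_apply]
  simp only [Complex.sub_re, Complex.sub_im, Complex.ofReal_re, Complex.ofReal_im]
  linarith

/-- If all the roots of a split polynomial are closer to `x` than to `y`, then the polynomial is
smaller at `x` than at `y`. -/
theorem Polynomial.Splits.norm_eval_lt_norm_eval {K : Type*} [NormedField K] {g : K[X]}
    (hg : g.Splits) (hdeg : g.natDegree ≠ 0) {x y : K} (hx : g.eval x ≠ 0)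
    (h : ∀ z, g.IsRoot z → ‖x - z‖ < ‖y - z‖) : ‖g.eval x‖ < ‖g.eval y‖ := by
  have hg0 : g ≠ 0 := by rintro rfl; simp at hdeg
  have norm_eval (w : K) :
      ‖g.eval w‖ = ‖g.leadingCoeff‖ * (g.roots.map fun z => ‖w - z‖).prod := by
    rw [hg.eval_eq_prod_roots, norm_mul]
    congr 1
    simpa [Multiset.map_map, Function.comp_def] using
      map_multiset_prod (normHom : K →*₀ ℝ) (g.roots.map (w - ·))
  rw [norm_eval, norm_eval]
  refine mul_lt_mul_of_pos_left ?_ (norm_pos_iff.2 (leadingCoeff_ne_zero.2 hg0))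
  refine Multiset.prod_map_lt_prod_map ?_ _ _ (fun z hz => ?_) fun z hz =>
    h z (isRoot_of_mem_roots hz)
  · rwa [← Multiset.card_pos, ← hg.natDegree_eq_card_roots, pos_iff_ne_zero]
  · rw [norm_pos_iff, sub_ne_zero]
    rintro rfl
    exact hx (isRoot_of_mem_roots hz)

theorem natAbs_eval_lt_natAbs_eval_of_dvd {f g : ℤ[X]} {a b : ℤ} (hab : a ^ 2 < b ^ 2)
    (hlead : ∑ i ∈ Finset.range f.natDegree,
        ((|f.coeff i| : ℤ) : ℝ) * (((|a + b| : ℤ) : ℝ) / 2) ^ ((i : ℤ) - (f.natDegree : ℤ)) <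
      ((|f.leadingCoeff| : ℤ) : ℝ))
    (hgf : g ∣ f) (hdeg : g.natDegree ≠ 0) (hga : g.eval a ≠ 0) :
    (g.eval a).natAbs < (g.eval b).natAbs := by
  have hsum : a + b ≠ 0 := fun h => by
    rw [eq_neg_of_add_eq_zero_left h] at hab
    simp at hab
  have hρ : (0 : ℝ) < ((|a + b| : ℤ) : ℝ) / 2 := by
    have : (0 : ℝ) < ((|a + b| : ℤ) : ℝ) := by exact_mod_cast abs_pos.2 hsum
    positivity
  have hinj : Function.Injective (Int.castRingHom ℂ) := Int.cast_injective
  have eval_map_intCast (x : ℤ) : (g.map (Int.castRingHom ℂ)).eval (x : ℂ) = (g.eval x : ℤ) := by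
    simp
  have hroot : ∀ z, (g.map (Int.castRingHom ℂ)).IsRoot z →
      ‖(a : ℂ) - z‖ < ‖(b : ℂ) - z‖ := by
    intro z hz
    have hfz : (f.map (Int.castRingHom ℂ)).IsRoot z := hz.dvd (Polynomial.map_dvd _ hgf)
    have hlt : ‖z‖ < ((|a + b| : ℤ) : ℝ) / 2 := by
      refine hfz.norm_lt_of_sum_lt_norm_leadingCoeff hρ ?_
      rw [leadingCoeff_map_of_injective hinj, natDegree_map_eq_of_injective hinj]
      simpa using hlead
    have hab' : (a : ℝ) ^ 2 < (b : ℝ) ^ 2 := by exact_mod_cast hab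
    simpa using Complex.norm_ofReal_sub_lt_of_norm_lt hab' (z := z) (by simpa using hlt)
  have hlt := (IsAlgClosed.splits (g.map (Int.castRingHom ℂ))).norm_eval_lt_norm_eval
    (by rwa [natDegree_map_eq_of_injective hinj])
    (by rw [eval_map_intCast]; exact_mod_cast hga) hroot
  rw [eval_map_intCast, eval_map_intCast, Complex.norm_intCast, Complex.norm_intCast] at hlt
  zify
  exact_mod_cast hlt

theorem Nat.Prime.pow_dvd_or_pow_dvd_of_mul {p u m n : ℕ} (hp : p.Prime) (h : p ^ u ∣ m * n)
    (hmn : ¬(p ∣ m ∧ p ∣ n)) : p ^ u ∣ m ∨ p ^ u ∣ n := by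
  by_cases hm : p ∣ m
  · have hn : ¬p ∣ n := fun hn => hmn ⟨hm, hn⟩
    exact .inl (((hp.coprime_iff_not_dvd.2 hn).pow_left u).dvd_of_dvd_mul_right h)
  · exact .inr (((hp.coprime_iff_not_dvd.2 hm).pow_left u).dvd_of_dvd_mul_left h)

/-- If a product of two distinct prime powers is factored so that neither prime divides both
factors, then the prime powers are distributed between the two factors. -/
theorem Nat.Prime.factorization_of_mul_eq_pow_mul_pow {p q u v m n : ℕ} (hp : p.Prime)
    (hq : q.Prime) (hpq : p ≠ q) (h : m * n = p ^ u * q ^ v) (hpmn : ¬(p ∣ m ∧ p ∣ n))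
    (hqmn : ¬(q ∣ m ∧ q ∣ n)) :
    (m = p ^ u * q ^ v ∧ n = 1) ∨ (m = p ^ u ∧ n = q ^ v) ∨
      (m = q ^ v ∧ n = p ^ u) ∨ (m = 1 ∧ n = p ^ u * q ^ v) := by
  have hcop : Nat.Coprime (p ^ u) (q ^ v) := Nat.coprime_pow_primes u v hp hq hpq
  have hP : 0 < p ^ u := pow_pos hp.pos u
  have hQ : 0 < q ^ v := pow_pos hq.pos v
  have hP' := hp.pow_dvd_or_pow_dvd_of_mul (u := u) (by rw [h]; exact dvd_mul_right _ _) hpmn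
  have hQ' := hq.pow_dvd_or_pow_dvd_of_mul (u := v) (by rw [h]; exact dvd_mul_left _ _) hqmn
  generalize p ^ u = P at *
  generalize q ^ v = Q at *
  have cancel {c d : ℕ} (h : P * Q * (c * d) = P * Q) : c = 1 ∧ d = 1 :=
    mul_eq_one.1 (Nat.eq_of_mul_eq_mul_left (Nat.mul_pos hP hQ) (by rw [h, mul_one]))
  rcases hP' with hPm | hPn <;> rcases hQ' with hQm | hQn
  · obtain ⟨c, rfl⟩ := hcop.mul_dvd_of_dvd_of_dvd hPm hQm
    obtain ⟨rfl, rfl⟩ := cancel (c := c) (d := n) (by rw [← mul_assoc, h])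
    simp
  · obtain ⟨c, rfl⟩ := hPm
    obtain ⟨d, rfl⟩ := hQn
    obtain ⟨rfl, rfl⟩ := cancel (c := c) (d := d) (Eq.trans (by ring) h)
    simp
  · obtain ⟨c, rfl⟩ := hPn
    obtain ⟨d, rfl⟩ := hQm
    obtain ⟨rfl, rfl⟩ := cancel (c := c) (d := d) (Eq.trans (by ring) h)
    simp
  · obtain ⟨c, rfl⟩ := hcop.mul_dvd_of_dvd_of_dvd hPn hQn
    obtain ⟨rfl, rfl⟩ := cancel (c := c) (d := m) (Eq.trans (by ring) h)
    simp

theorem Polynomial.not_dvd_eval_and_dvd_eval_of_not_dvd_derivative_mul {g h : ℤ[X]} {x : ℤ}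
    {p : ℕ}
    (hp : ¬(p : ℤ) ∣ (g * h).derivative.eval x) :
    ¬(p ∣ (g.eval x).natAbs ∧ p ∣ (h.eval x).natAbs) := by
  rintro ⟨hg, hh⟩
  refine hp ?_
  rw [derivative_mul, eval_add, eval_mul, eval_mul]
  exact dvd_add ((Int.natCast_dvd.2 hh).mul_left _) ((Int.natCast_dvd.2 hg).mul_right _)

theorem statement_17 (f : Polynomial ℤ) (hdeg : 1 ≤ f.natDegree) (a b : ℤ)
    (hab : a ^ 2 < b ^ 2)
    (hlead : ((|f.leadingCoeff| : ℤ) : ℝ) >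
      ∑ i ∈ Finset.range f.natDegree,
        ((|f.coeff i| : ℤ) : ℝ) * (((|a + b| : ℤ) : ℝ) / 2) ^ ((i : ℤ) - (f.natDegree : ℤ)))
    (p q r s : ℕ) (hp : p.Prime) (hq : q.Prime) (hr : r.Prime) (hs : s.Prime)
    (hpq : p ≠ q) (hpr : p ≠ r) (hps : p ≠ s)
    (hqr : q ≠ r) (hqs : q ≠ s) (hrs : r ≠ s)
    (u v k l : ℕ) (hu : 1 ≤ u) (hv : 1 ≤ v) (hk : 1 ≤ k) (hl : 1 ≤ l)
    (h1 : (r : ℤ) ^ k < (p : ℤ) ^ u) (h2 : (s : ℤ) ^ l < (r : ℤ) ^ k)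
    (h3 : (q : ℤ) ^ v < (s : ℤ) ^ l)
    (h4 : (p : ℤ) ^ u * (q : ℤ) ^ v < (r : ℤ) ^ k * (s : ℤ) ^ l)
    (hfa : |f.eval a| = (p : ℤ) ^ u * (q : ℤ) ^ v)
    (hfb : |f.eval b| = (r : ℤ) ^ k * (s : ℤ) ^ l)
    (hpd : ¬ ((p : ℤ) ∣ f.derivative.eval a))
    (hqd : ¬ ((q : ℤ) ∣ f.derivative.eval a))
    (hrd : ¬ ((r : ℤ) ∣ f.derivative.eval b))
    (hsd : ¬ ((s : ℤ) ∣ f.derivative.eval b)) :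
    Irreducible (Polynomial.map (Int.castRingHom ℚ) f) := by
  have hfac_a : ∀ g h : ℤ[X], f = g * h →
      (g.eval a).natAbs * (h.eval a).natAbs = p ^ u * q ^ v := by
    rintro g h rfl
    rw [← Int.natAbs_mul, ← eval_mul]
    zify
    exact hfa
  have hfac_b : ∀ g h : ℤ[X], f = g * h →
      (g.eval b).natAbs * (h.eval b).natAbs = r ^ k * s ^ l := by
    rintro g h rfl
    rw [← Int.natAbs_mul, ← eval_mul]
    zify
    exact hfb
  refine irreducible_map_rat_of_forall_natDegree_eq_zero (by omega) fun g h hgh => ?_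
  by_contra! hne
  have hfa0 : f.eval a ≠ 0 := by
    rw [← abs_pos, hfa]
    have := hp.pos
    have := hq.pos
    positivity
  have hg0 : g.eval a ≠ 0 := fun h0 => hfa0 (by rw [hgh, eval_mul, h0, zero_mul])
  have hh0 : h.eval a ≠ 0 := fun h0 => hfa0 (by rw [hgh, eval_mul, h0, mul_zero])
  have hltg := natAbs_eval_lt_natAbs_eval_of_dvd hab hlead (Dvd.intro _ hgh.symm) hne.1 hg0
  have hlth := natAbs_eval_lt_natAbs_eval_of_dvd hab hlead (Dvd.intro_left _ hgh.symm) hne.2 hh0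
  have ha := hfac_a g h hgh
  have hb := hfac_b g h hgh
  rw [hgh] at hpd hqd hrd hsd
  have ha' := hp.factorization_of_mul_eq_pow_mul_pow hq hpq ha
    (not_dvd_eval_and_dvd_eval_of_not_dvd_derivative_mul hpd)
    (not_dvd_eval_and_dvd_eval_of_not_dvd_derivative_mul hqd)
  have hb' := hr.factorization_of_mul_eq_pow_mul_pow hs hrs hb
    (not_dvd_eval_and_dvd_eval_of_not_dvd_derivative_mul hrd)
    (not_dvd_eval_and_dvd_eval_of_not_dvd_derivative_mul hsd)
  have hQ : 0 < q ^ v := pow_pos hq.pos v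
  have hrp : r ^ k < p ^ u := by exact_mod_cast h1
  have hsr : s ^ l < r ^ k := by exact_mod_cast h2
  have hP : p ^ u ≤ p ^ u * q ^ v := Nat.le_mul_of_pos_right _ hQ
  clear ha hb
  rcases ha' with ⟨e1, e2⟩ | ⟨e1, e2⟩ | ⟨e1, e2⟩ | ⟨e1, e2⟩ <;>
    rcases hb' with ⟨e3, e4⟩ | ⟨e3, e4⟩ | ⟨e3, e4⟩ | ⟨e3, e4⟩ <;>
    rw [e1, e3] at hltg <;> rw [e2, e4] at hlth <;> omega
end
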